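/- The function ψ : ℝ × ℝ → ℂ defined by ψ(x, t) = exp(x + it/2) satisfies i ∂_t ψ + (1/2) ∂²_x ψ = 0 on all of ℝ²; its Taylor polynomial of order 2 (degree 1) centered at (0, 0) equals T(x, t) = 1 + x + (i/2) t; and T does not satisfy the Schrödinger equation: i ∂_t T + (1/2) ∂²_x T = −1/2 ≠ 0. In particular, the Taylor polynomial of order p + 1 of a Trefftz function need not be a Trefftz polynomial (here with p = 1). -/

import Mathlib

noncomputable section

/-- Partial derivative in `x` of a function on `ℝ × ℝ`. -/
def pX (f : ℝ × ℝ → ℂ) : ℝ × ℝ → ℂ := fun y => fderiv ℝ f y (1, 0)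

/-- Partial derivative in `t` of a function on `ℝ × ℝ`. -/
def pT (f : ℝ × ℝ → ℂ) : ℝ × ℝ → ℂ := fun y => fderiv ℝ f y (0, 1)

/-- The affine function `(x, t) ↦ a + b x + c t` has derivative `(u, v) ↦ b u + c v`. -/
theorem hasFDerivAt_affine (a b c : ℂ) (y : ℝ × ℝ) :
    HasFDerivAt (fun y : ℝ × ℝ => a + b * (y.1 : ℂ) + c * (y.2 : ℂ))
      (b • Complex.ofRealCLM.comp (ContinuousLinearMap.fst ℝ ℝ ℝ) +
        c • Complex.ofRealCLM.comp (ContinuousLinearMap.snd ℝ ℝ ℝ)) y :=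
  (((Complex.ofRealCLM.comp (ContinuousLinearMap.fst ℝ ℝ ℝ)).hasFDerivAt.const_mul b).const_add
    a).add ((Complex.ofRealCLM.comp (ContinuousLinearMap.snd ℝ ℝ ℝ)).hasFDerivAt.const_mul c)

theorem pX_affine (a b c : ℂ) :
    pX (fun y : ℝ × ℝ => a + b * (y.1 : ℂ) + c * (y.2 : ℂ)) = fun _ => b := by
  funext y
  simp [pX, (hasFDerivAt_affine a b c y).fderiv]

theorem pT_affine (a b c : ℂ) :
    pT (fun y : ℝ × ℝ => a + b * (y.1 : ℂ) + c * (y.2 : ℂ)) = fun _ => c := by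
  funext y
  simp [pT, (hasFDerivAt_affine a b c y).fderiv]

theorem pX_const (a : ℂ) : pX (fun _ => a) = fun _ => 0 := by
  funext y
  simp [pX]

theorem pX_exp_affine (a b c : ℂ) :
    pX (fun y : ℝ × ℝ => Complex.exp (a + b * (y.1 : ℂ) + c * (y.2 : ℂ))) =
      fun y => b * Complex.exp (a + b * (y.1 : ℂ) + c * (y.2 : ℂ)) := by
  funext y
  simp [pX, (hasFDerivAt_affine a b c y).cexp.fderiv, mul_comm]

theorem pT_exp_affine (a b c : ℂ) :
    pT (fun y : ℝ × ℝ => Complex.exp (a + b * (y.1 : ℂ) + c * (y.2 : ℂ))) =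
      fun y => c * Complex.exp (a + b * (y.1 : ℂ) + c * (y.2 : ℂ)) := by
  funext y
  simp [pT, (hasFDerivAt_affine a b c y).cexp.fderiv, mul_comm]

/-- The function `ψ(x, t) = exp(x + it/2)` satisfies `i ∂_t ψ + (1/2) ∂²_x ψ = 0` on all of
`ℝ²`; its Taylor polynomial of order `2` centered at `(0,0)`,
`T(x,t) = ψ(0,0) + ∂_x ψ(0,0) x + ∂_t ψ(0,0) t`, equals `1 + x + (i/2) t`; and `T` is not
Trefftz: `i ∂_t T + (1/2) ∂²_x T = −1/2 ≠ 0`. -/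
theorem taylor_of_trefftz_not_trefftz :
    let ψ : ℝ × ℝ → ℂ := fun y => Complex.exp ((y.1 : ℂ) + Complex.I * (y.2 : ℂ) / 2)
    let T : ℝ × ℝ → ℂ := fun y => 1 + (y.1 : ℂ) + (Complex.I / 2) * (y.2 : ℂ)
    (∀ y : ℝ × ℝ, Complex.I * pT ψ y + (1/2 : ℂ) * pX (pX ψ) y = 0) ∧
    (∀ y : ℝ × ℝ,
      ψ (0, 0) + pX ψ (0, 0) * (y.1 : ℂ) + pT ψ (0, 0) * (y.2 : ℂ) = T y) ∧
    (∀ y : ℝ × ℝ, Complex.I * pT T y + (1/2 : ℂ) * pX (pX T) y = -1/2) ∧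
    (-1/2 : ℂ) ≠ 0 := by
  intro ψ T
  have hψ : ψ = fun y => Complex.exp (0 + 1 * (y.1 : ℂ) + Complex.I / 2 * (y.2 : ℂ)) := by
    funext y
    simp only [ψ]
    congr 1
    ring
  have hT : T = fun y => 1 + 1 * (y.1 : ℂ) + Complex.I / 2 * (y.2 : ℂ) := by
    funext y
    simp only [T, one_mul]
  have hx : pX ψ = ψ := by
    rw [hψ, pX_exp_affine]
    simp only [one_mul]
  have ht : pT ψ = fun y => Complex.I / 2 * ψ y := by
    rw [hψ, pT_exp_affine]
  have h0 : ψ (0, 0) = 1 := by simp [ψ]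
  refine ⟨fun y => ?_, fun y => ?_, fun y => ?_, by norm_num⟩
  · rw [hx, hx, ht]
    linear_combination (ψ y / 2) * Complex.I_mul_I
  · rw [hx, ht]
    simp only [h0, T]
    ring
  · rw [hT, pT_affine, pX_affine, pX_const]
    linear_combination (1 / 2 : ℂ) * Complex.I_mul_I
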